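/- arXiv:2510.00979 — 3 statements merged into one kernel-verified Lean document; each statement's English description precedes it below -/
import Mathlib

section
/- Let n, p be positive integers with p ∣ n, and let x : ℂ^n. For all integers k with 0 ≤ k < n/p and s with 0 ≤ s < p, the value of the length-n discrete Fourier transform of x at index k + s·(n/p) satisfies (F_n x)_{k + s·(n/p)} = Σ_{t=0}^{p-1} ω_p^{st} · ω_n^{kt} · (F_{n/p} x^{(t)})_k, where x^{(t)} : ℂ^{n/p} is the strided subarray x^{(t)}_c = x_{t + c·p} for 0 ≤ c < n/p. (This is the correctness of the sequential four-step FFT framework: Step 1 computes F_{n/p} on each strided subarray, Step 2 multiplies by the twiddle factors ω_n^{kt}, and Step 4 applies F_p across the results.) -/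
open Finset

/-- The discrete Fourier transform of length `n`:
`(F_n x)_k = ∑_{j=0}^{n-1} x_j ω_n^{jk}` with `ω_n = exp(-2πi/n)`. -/
noncomputable def dft (n : ℕ) (x : Fin n → ℂ) : Fin n → ℂ :=
  fun k => ∑ j : Fin n, x j * Complex.exp (-2 * Real.pi * Complex.I / n) ^ (j.val * k.val)

/-- For `n = m * d`, the `d`-th power of `ω_n` is `ω_m`. -/
theorem dft_root_pow {n m d : ℕ} (hd : 0 < d) (h : m * d = n) :
    Complex.exp (-2 * Real.pi * Complex.I / n) ^ d =
      Complex.exp (-2 * Real.pi * Complex.I / m) := by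
  have hd' : (d : ℂ) ≠ 0 := Nat.cast_ne_zero.mpr hd.ne'
  rw [← Complex.exp_nat_mul, ← h, Nat.cast_mul, mul_div_left_comm, mul_comm (m : ℂ),
    ← div_div, div_self hd', mul_one_div]

/-- The `n`-th power of `ω_n` is `1`. -/
theorem dft_root_pow_self {n : ℕ} (hn : 0 < n) :
    Complex.exp (-2 * Real.pi * Complex.I / n) ^ n = 1 := by
  rw [dft_root_pow hn (one_mul n), Nat.cast_one, div_one, neg_mul, neg_mul, Complex.exp_neg,
    Complex.exp_two_pi_mul_I, inv_one]

/-- Correctness of the sequential four-step FFT framework: for `p ∣ n`,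
`0 ≤ k < n/p` and `0 ≤ s < p`,
`(F_n x)_{k + s·(n/p)} = ∑_{t=0}^{p-1} ω_p^{st} · ω_n^{kt} · (F_{n/p} x⁽ᵗ⁾)_k`,
where `x⁽ᵗ⁾_c = x_{t + c·p}`. -/
theorem fourStepFFT_correct (n p : ℕ) (hn : 0 < n) (hp : 0 < p) (hdvd : p ∣ n)
    (x : Fin n → ℂ) (k s : ℕ) (hk : k < n / p) (hs : s < p) :
    dft n x ⟨k + s * (n / p), by
        have h1 : n / p * p = n := Nat.div_mul_cancel hdvd
        nlinarith⟩ =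
      ∑ t : Fin p,
        Complex.exp (-2 * Real.pi * Complex.I / p) ^ (s * t.val) *
          Complex.exp (-2 * Real.pi * Complex.I / n) ^ (k * t.val) *
          dft (n / p)
            (fun c => x ⟨t.val + c.val * p, by
              have h1 : n / p * p = n := Nat.div_mul_cancel hdvd
              have h2 := c.isLt
              have h3 := t.isLt
              nlinarith⟩)
            ⟨k, hk⟩ := by
  have h1 : n / p * p = n := Nat.div_mul_cancel hdvd
  have hm : 0 < n / p := by omega
  have hω := dft_root_pow_self hn
  simp only [dft, Finset.mul_sum]
  rw [← dft_root_pow hp h1, ← dft_root_pow hm ((mul_comm p (n / p)).trans h1),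
    ← (finProdFinEquiv.trans (finCongr h1)).sum_comp, Fintype.sum_prod_type_right]
  refine Finset.sum_congr rfl fun t _ => Finset.sum_congr rfl fun c _ => ?_
  have hx : finProdFinEquiv.trans (finCongr h1) (c, t) =
      ⟨t.val + c.val * p, by have h2 := c.isLt; have h3 := t.isLt; nlinarith⟩ :=
    Fin.ext (by simp [mul_comm])
  rw [hx]
  generalize Complex.exp (-2 * Real.pi * Complex.I / n) = ω at hω ⊢
  have he : (t.val + c.val * p) * (k + s * (n / p)) =
      n / p * (s * t.val) + k * t.val + p * (c.val * k) + n * (c.val * s) := by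
    linear_combination (c.val * s) * h1
  rw [he, pow_add, pow_mul ω n, hω, one_pow, mul_one, pow_add, pow_add, ← pow_mul, ← pow_mul]
  ring
end

section
/- Let d be a positive integer, n : Fin d → ℕ with each n_l ≥ 1, and p : Fin d → ℕ with each p_l ≥ 1 and p_l ∣ n_l. Let X : (Π l, Fin n_l) → ℂ be a rank-d array. For all multi-indices k with 0 ≤ k_l < n_l/p_l for each l and s with 0 ≤ s_l < p_l for each l, the rank-d discrete Fourier transform satisfies (F_{n_1} ⊗ ⋯ ⊗ F_{n_d})(X) at global index (k_1 + s_1·(n_1/p_1), …, k_d + s_d·(n_d/p_d)) equals Σ_{t ∈ [p_1]×⋯×[p_d]} (∏_{l=1}^d ω_{p_l}^{s_l t_l} ω_{n_l}^{k_l t_l}) · G^{(t)}_k, where G^{(t)} is the rank-d DFT of size (n_1/p_1, …, n_d/p_d) applied to the strided subarray X^{(t)}_c = X_{(t_1 + c_1 p_1, …, t_d + c_d p_d)}. (This is the correctness of the rank-d four-step FFT framework obtained as the tensor product of the rank-1 algorithm.) -/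
open Finset

/-- The rank-`d` discrete Fourier transform:
`Y_k = ∑_j X_j ∏_l ω_{n_l}^{j_l k_l}` with `ω_m = exp(-2πi/m)`. -/
noncomputable def dftd (d : ℕ) (n : Fin d → ℕ) (X : (∀ l, Fin (n l)) → ℂ) :
    (∀ l, Fin (n l)) → ℂ :=
  fun k => ∑ j : ∀ l, Fin (n l),
    X j * ∏ l, Complex.exp (-2 * Real.pi * Complex.I / (n l)) ^ ((j l).val * (k l).val)

/-- `exp (-2πi / (q * p)) ^ q = exp (-2πi / p)`. -/
lemma exp_two_pi_div_mul_pow (q p : ℕ) (hq : q ≠ 0) :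
    Complex.exp (-2 * Real.pi * Complex.I / ((q * p : ℕ) : ℂ)) ^ q =
      Complex.exp (-2 * Real.pi * Complex.I / (p : ℂ)) := by
  rw [← Complex.exp_nat_mul, Nat.cast_mul, mul_div_assoc',
    mul_div_mul_left _ _ (Nat.cast_ne_zero.mpr hq)]

lemma exp_two_pi_div_pow_self (n : ℕ) (hn : n ≠ 0) :
    Complex.exp (-2 * Real.pi * Complex.I / (n : ℂ)) ^ n = 1 := by
  have h := exp_two_pi_div_mul_pow n 1 hn
  rw [mul_one, Nat.cast_one, div_one] at h
  rw [h, neg_mul, neg_mul, Complex.exp_neg, Complex.exp_two_pi_mul_I, inv_one]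

/-- Splitting of the twiddle factors in one coordinate. -/
lemma exp_two_pi_div_pow_split (n p : ℕ) (hn : 0 < n) (hp : 0 < p) (hdvd : p ∣ n)
    (t c k s : ℕ) :
    Complex.exp (-2 * Real.pi * Complex.I / (n : ℂ)) ^ ((t + c * p) * (k + s * (n / p))) =
      Complex.exp (-2 * Real.pi * Complex.I / (p : ℂ)) ^ (s * t) *
        Complex.exp (-2 * Real.pi * Complex.I / (n : ℂ)) ^ (k * t) *
        Complex.exp (-2 * Real.pi * Complex.I / ((n / p : ℕ) : ℂ)) ^ (c * k) := by
  obtain ⟨q, rfl⟩ := hdvd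
  have hq : q ≠ 0 := by rintro rfl; simp at hn
  rw [Nat.mul_div_cancel_left q hp, ← exp_two_pi_div_mul_pow q p hq,
    ← exp_two_pi_div_mul_pow p q hp.ne', mul_comm q p]
  have h1 := exp_two_pi_div_pow_self (p * q) hn.ne'
  generalize Complex.exp (-2 * Real.pi * Complex.I / ((p * q : ℕ) : ℂ)) = w at h1 ⊢
  calc w ^ ((t + c * p) * (k + s * q))
      = (w ^ q) ^ (s * t) * w ^ (k * t) * (w ^ p) ^ (c * k) * (w ^ (p * q)) ^ (c * s) := by
        simp only [← pow_mul, ← pow_add]; congr 1; ring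
    _ = _ := by rw [h1, one_pow, mul_one]

/-- Coordinatewise division with remainder: a pair of a remainder `t` and a quotient `c`
corresponds to the index `t + c * p`. -/
def stridedIndexEquiv {ι : Type*} (n p : ι → ℕ) (hdvd : ∀ l, p l ∣ n l) :
    ((∀ l, Fin (p l)) × (∀ l, Fin (n l / p l))) ≃ (∀ l, Fin (n l)) where
  toFun x l := finCongr (Nat.div_mul_cancel (hdvd l)) (finProdFinEquiv (x.2 l, x.1 l))
  invFun j :=
    (fun l => (finProdFinEquiv.symm (finCongr (Nat.div_mul_cancel (hdvd l)).symm (j l))).2,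
      fun l => (finProdFinEquiv.symm (finCongr (Nat.div_mul_cancel (hdvd l)).symm (j l))).1)
  left_inv x := by
    have h (l) : finCongr (Nat.div_mul_cancel (hdvd l)).symm
        (finCongr (Nat.div_mul_cancel (hdvd l)) (finProdFinEquiv (x.2 l, x.1 l))) =
        finProdFinEquiv (x.2 l, x.1 l) := rfl
    simp only [h, Equiv.symm_apply_apply]
  right_inv j := by
    funext l
    simp only [Prod.mk.eta, Equiv.apply_symm_apply]
    rfl

lemma stridedIndexEquiv_apply_val {ι : Type*} (n p : ι → ℕ) (hdvd : ∀ l, p l ∣ n l)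
    (x : (∀ l, Fin (p l)) × (∀ l, Fin (n l / p l))) (l : ι) :
    (stridedIndexEquiv n p hdvd x l).val = (x.1 l).val + (x.2 l).val * p l := by
  simp [stridedIndexEquiv, finProdFinEquiv, mul_comm]

/-- Correctness of the rank-`d` four-step FFT framework, obtained as the tensor
product of the rank-1 four-step algorithm: with `p_l ∣ n_l`, for local indices
`k_l < n_l/p_l` and processor indices `s_l < p_l`,
`((F_{n_1} ⊗ ⋯ ⊗ F_{n_d}) X)_{(k_l + s_l·(n_l/p_l))_l}
  = ∑_{t} (∏_l ω_{p_l}^{s_l t_l} ω_{n_l}^{k_l t_l}) · G⁽ᵗ⁾_k`,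
where `G⁽ᵗ⁾` is the rank-`d` DFT of size `(n_l/p_l)_l` of the strided subarray
`X⁽ᵗ⁾_c = X_{(t_l + c_l·p_l)_l}`. -/
theorem fourStepFFT_rank_d_correct (d : ℕ) (hd : 0 < d) (n p : Fin d → ℕ)
    (hn : ∀ l, 0 < n l) (hp : ∀ l, 0 < p l) (hdvd : ∀ l, p l ∣ n l)
    (X : (∀ l, Fin (n l)) → ℂ)
    (k : ∀ l, Fin (n l / p l)) (s : ∀ l, Fin (p l)) :
    dftd d n X (fun l => ⟨(k l).val + (s l).val * (n l / p l), by
        have h1 : n l / p l * p l = n l := Nat.div_mul_cancel (hdvd l)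
        have h2 := (k l).isLt
        have h3 := (s l).isLt
        nlinarith⟩) =
      ∑ t : ∀ l, Fin (p l),
        (∏ l, Complex.exp (-2 * Real.pi * Complex.I / (p l)) ^ ((s l).val * (t l).val) *
            Complex.exp (-2 * Real.pi * Complex.I / (n l)) ^ ((k l).val * (t l).val)) *
          dftd d (fun l => n l / p l)
            (fun c => X (fun l => ⟨(t l).val + (c l).val * p l, by
              have h1 : n l / p l * p l = n l := Nat.div_mul_cancel (hdvd l)
              have h2 := (c l).isLt
              have h3 := (t l).isLt
              nlinarith⟩))
            k := by
  simp only [dftd, Finset.mul_sum]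
  rw [← (stridedIndexEquiv n p hdvd).sum_comp, Fintype.sum_prod_type]
  refine Finset.sum_congr rfl fun t _ => Finset.sum_congr rfl fun c _ => ?_
  rw [mul_left_comm, ← Finset.prod_mul_distrib]
  congr 1
  · congr 1
    funext l
    exact Fin.ext (stridedIndexEquiv_apply_val n p hdvd (t, c) l)
  · refine Finset.prod_congr rfl fun l _ => ?_
    rw [stridedIndexEquiv_apply_val]
    exact exp_two_pi_div_pow_split (n l) (p l) (hn l) (hp l) (hdvd l) _ _ _ _
end

section
/- Let n, p be positive integers with p² ∣ n. Then the map r : [p] × [n/p] → [p] × [n/p] defined by r(s, k) = (k mod p, s·(n/p²) + k div p) is a bijection. (This is the permutation of the global index set performed by the communication superstep of the parallel four-step FFT framework.) -/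
/-- Euclidean division has a unique quotient and remainder. -/
theorem Nat.eq_and_eq_of_mul_add_eq_mul_add {m a b c d : ℕ} (hb : b < m) (hd : d < m)
    (h : a * m + b = c * m + d) : a = c ∧ b = d := by
  have hm : 0 < m := by omega
  constructor
  · have := congrArg (· / m) h
    simpa [Nat.add_div_of_dvd_right, Nat.mul_div_cancel _ hm, Nat.div_eq_of_lt hb,
      Nat.div_eq_of_lt hd] using this
  · have := congrArg (· % m) h
    simpa [Nat.mod_eq_of_lt hb, Nat.mod_eq_of_lt hd] using this

/-- The communication superstep of the parallel four-step FFT framework permutes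
the global index set: for `p² ∣ n`, the map
`r : [p] × [n/p] → [p] × [n/p]`, `r(s, k) = (k mod p, s·(n/p²) + k div p)`
is a bijection. -/
theorem fft_comm_superstep_bijective (n p : ℕ) (hn : 0 < n) (hp : 0 < p)
    (hdvd : p ^ 2 ∣ n) :
    Function.Bijective (fun sk : Fin p × Fin (n / p) =>
      ((⟨sk.2.val % p, Nat.mod_lt _ hp⟩ : Fin p),
       (⟨sk.1.val * (n / p ^ 2) + sk.2.val / p, by
          have h1 : n / p ^ 2 * p = n / p := by
            rw [pow_two, ← Nat.div_div_eq_div_mul]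
            exact Nat.div_mul_cancel (Nat.dvd_div_of_mul_dvd (by rwa [← pow_two]))
          have h2 : sk.2.val / p < n / p ^ 2 :=
            (Nat.div_lt_iff_lt_mul hp).mpr (by rw [h1]; exact sk.2.isLt)
          have h3 : (sk.1.val + 1) * (n / p ^ 2) ≤ p * (n / p ^ 2) :=
            Nat.mul_le_mul_right _ (Nat.succ_le_of_lt sk.1.isLt)
          have h4 : sk.1.val * (n / p ^ 2) + n / p ^ 2 = (sk.1.val + 1) * (n / p ^ 2) := by
            ring
          have h5 : p * (n / p ^ 2) = n / p := by rw [mul_comm]; exact h1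
          linarith⟩ : Fin (n / p)))) := by
  rw [← Finite.injective_iff_bijective]
  rintro ⟨s, k⟩ ⟨t, l⟩ h
  simp only [Prod.mk.injEq, Fin.mk.injEq] at h
  obtain ⟨hmod, hdiv⟩ := h
  have hnp : n / p ^ 2 * p = n / p := by
    rw [pow_two, ← Nat.div_div_eq_div_mul]
    exact Nat.div_mul_cancel (Nat.dvd_div_of_mul_dvd (by rwa [← pow_two]))
  have hlt (j : Fin (n / p)) : j.val / p < n / p ^ 2 :=
    (Nat.div_lt_iff_lt_mul hp).mpr (hnp.symm ▸ j.isLt)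
  obtain ⟨hst, hkl⟩ := Nat.eq_and_eq_of_mul_add_eq_mul_add (hlt k) (hlt l) hdiv
  refine Prod.ext (Fin.ext hst) (Fin.ext ?_)
  rw [← Nat.div_add_mod k.val p, ← Nat.div_add_mod l.val p, hkl, hmod]
end
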